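/- For every integer n ≥ 1: ∑_{j=0}^{n} (−1)^{n−j} · D_j^{−1} · L_{n−j}^{−q^j} = 0. Equivalently, the 𝔽_q-linear formal power series exp(ξ) = ∑_{i≥0} ξ^{q^i}/D_i and log(ξ) = ∑_{j≥0} (−1)^j ξ^{q^j}/L_j are compositional inverses of each other; i.e., the explicit products L_j are precisely the coefficients of the logarithm function log_{(0)} of the standard rank-one Drinfeld A-module Ψ. -/

import Mathlib

open Finset in
/-- A product over an initial segment of an `N`-periodic sequence, collected by residue class. -/
theorem prod_range_eq_prod_pow_of_periodic {M : Type*} [CommMonoid M] {N : ℕ} (hN : 0 < N)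
    {g : ℕ → M} (hg : Function.Periodic g N) (n : ℕ) :
    ∏ i ∈ range n, g i = ∏ k ∈ range N, g k ^ ((n + N - k - 1) / N) := by
  induction n with
  | zero =>
    refine (prod_eq_one fun k hk => ?_).symm
    rw [Nat.div_eq_of_lt (by omega), pow_zero]
  | succ n ih =>
    have step : ∀ k ∈ range N, g k ^ ((n + 1 + N - k - 1) / N)
        = g k ^ ((n + N - k - 1) / N) * if n % N = k then g k else 1 := by
      intro k hk
      rw [mem_range] at hk
      have hdvd : N ∣ n + N - k - 1 + 1 ↔ n % N = k := by
        have hmod : n + N - k - 1 + 1 = n + N - k := by omega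
        rw [hmod, ← Nat.modEq_iff_dvd' (by omega : k ≤ n + N), Nat.ModEq, Nat.add_mod_right,
          Nat.mod_eq_of_lt hk, eq_comm]
      rw [show n + 1 + N - k - 1 = n + N - k - 1 + 1 by omega, Nat.succ_div, pow_add]
      simp only [hdvd]
      split_ifs <;> simp
    rw [prod_range_succ, ih, prod_congr rfl step, prod_mul_distrib, prod_ite_eq,
      if_pos (mem_range.2 (Nat.mod_lt _ hN)), hg.map_mod_nat]

open Finset Polynomial in
/-- The divided difference of order `s + 1` of a product of `s` linear factors vanishes. -/
theorem sum_prod_sub_div_prod_sub_eq_zero {F : Type*} [Field F] {T : ℕ → F}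
    (hT : Function.Injective T) (E : ℕ → F) (s : ℕ) :
    ∑ j ∈ range (s + 2), (∏ m ∈ range s, (T j - E m))
      / ∏ m ∈ (range (s + 2)).erase j, (T j - T m) = 0 := by
  have hdeg : (∏ m ∈ range s, (X - C (E m))).degree = (s : WithBot ℕ) := by
    simp [degree_prod]
  have h := Lagrange.coeff_eq_sum (s := range (s + 2)) (v := T) hT.injOn
    (P := ∏ m ∈ range s, (X - C (E m)))
    (by rw [hdeg, card_range]; exact_mod_cast (by omega : s < s + 2))
  rw [coeff_eq_zero_of_degree_lt
    (by rw [hdeg, card_range]; exact_mod_cast (by omega : s < s + 2 - 1))] at h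
  simpa [eval_prod] using h.symm

open Finset in
theorem prod_erase_range_add {M : Type*} [CommMonoid M] (f : ℕ → M) (j r : ℕ) :
    ∏ m ∈ (range (j + r + 1)).erase j, f m
      = (∏ m ∈ range j, f m) * ∏ i ∈ range r, f (j + 1 + i) := by
  induction r with
  | zero => simp [range_add_one]
  | succ r ih =>
    rw [range_add_one, erase_insert_of_ne (by omega), prod_insert (by simp), ← add_assoc, ih,
      prod_range_succ _ r, show j + 1 + r = j + r + 1 by omega, mul_comm, mul_assoc]

section

variable {F : Type*} [Field F] {q : ℕ} {θ η : F}

open Finset in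
/-- The closed form of the reciprocals of the coefficients `D i`. -/
theorem inv_expDenominator_eq_prod
    (hfrob : ∀ (a : ℕ) (x y : F), (x - y) ^ q ^ a = x ^ q ^ a - y ^ q ^ a)
    {D : ℕ → F} (hD0 : D 0 = 1)
    (hDrec : ∀ i : ℕ, D (i + 1)
      = D i ^ q * (θ - θ ^ q ^ (i + 1)) / ((θ ^ q ^ (i + 1) - η) * (θ - η))) (n : ℕ) :
    (D n)⁻¹ = ∏ m ∈ range n, ((θ ^ q ^ n - η ^ q ^ m) * (θ ^ q ^ m - η ^ q ^ m)
      / (θ ^ q ^ m - θ ^ q ^ n)) := by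
  induction n with
  | zero => simp [hD0]
  | succ n ih =>
    have hfrob1 : ∀ x y : F, (x - y) ^ q = x ^ q - y ^ q := by simpa using hfrob 1
    have hpow : ∀ (x : F) (a : ℕ), (x ^ q ^ a) ^ q = x ^ q ^ (a + 1) := fun x a => by
      rw [← pow_mul, ← pow_succ]
    have hprod : (D n ^ q)⁻¹ = ∏ m ∈ range n, ((θ ^ q ^ (n + 1) - η ^ q ^ (m + 1))
        * (θ ^ q ^ (m + 1) - η ^ q ^ (m + 1)) / (θ ^ q ^ (m + 1) - θ ^ q ^ (n + 1))) := by
      rw [← inv_pow, ih, ← prod_pow]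
      simp only [div_pow, mul_pow, hfrob1, hpow]
    rw [hDrec, prod_range_succ', ← hprod, pow_zero, pow_one, pow_one]
    simp only [div_eq_mul_inv, mul_inv, inv_inv]
    ring

open Finset in
/-- The Frobenius twists of the reciprocals of the coefficients `L j`. -/
theorem inv_logDenominator_pow_eq_prod {N : ℕ} (hq : 2 ≤ q) (hN : 0 < N)
    (hfrob : ∀ (a : ℕ) (x y : F), (x - y) ^ q ^ a = x ^ q ^ a - y ^ q ^ a)
    (hper : η ^ q ^ N = η) {l : F} (r j : ℕ)
    (hl : l = (∏ m ∈ Icc 1 (r + 1), (θ - θ ^ q ^ m))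
        * ((θ - η) ^ ((q ^ (r + 1) - 1) / (q - 1)))⁻¹
        * ((θ - η ^ q ^ (N - 1)) ^ q ^ (r + 1))⁻¹
        * ∏ k ∈ range N, ((θ - η ^ q ^ k) ^ ((r + 1 + N - k - 2) / N))⁻¹) :
    (l ^ q ^ j)⁻¹ = (θ ^ q ^ (j + r + 1) - η ^ q ^ (j + r))
      * (∏ m ∈ range (r + 1), (θ ^ q ^ (j + m) - η ^ q ^ (j + m)))
      * (∏ i ∈ range r, (θ ^ q ^ j - η ^ q ^ (j + i)))
      / ∏ i ∈ range (r + 1), (θ ^ q ^ j - θ ^ q ^ (j + 1 + i)) := by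
  have hpow : ∀ (x : F) (a b : ℕ), (x ^ q ^ a) ^ q ^ b = x ^ q ^ (b + a) := fun x a b => by
    rw [← pow_mul, ← pow_add, add_comm]
  have hgeom : (θ - η) ^ ((q ^ (r + 1) - 1) / (q - 1))
      = ∏ m ∈ range (r + 1), (θ ^ q ^ m - η ^ q ^ m) := by
    rw [← Nat.geomSum_eq hq, ← prod_pow_eq_pow_sum]
    exact prod_congr rfl fun m _ => hfrob m θ η
  have htop : (θ - η ^ q ^ (N - 1)) ^ q ^ (r + 1) = θ ^ q ^ (r + 1) - η ^ q ^ r := by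
    rw [hfrob, hpow, show r + 1 + (N - 1) = r + N by omega, ← hpow η, hper]
  have hcollect : ∏ k ∈ range N, (θ - η ^ q ^ k) ^ ((r + 1 + N - k - 2) / N)
      = ∏ i ∈ range r, (θ - η ^ q ^ i) := by
    rw [prod_range_eq_prod_pow_of_periodic hN (g := fun i => θ - η ^ q ^ i)
      (fun i => by simp only [← hpow, hper])]
    refine prod_congr rfl fun k hk => ?_
    rw [mem_range] at hk
    rw [show r + 1 + N - k - 2 = r + N - k - 1 by omega]
  have hIcc : ∏ m ∈ Icc 1 (r + 1), (θ - θ ^ q ^ m)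
      = ∏ i ∈ range (r + 1), (θ - θ ^ q ^ (1 + i)) := by
    rw [← Ico_add_one_right_eq_Icc, prod_Ico_eq_prod_range]
    rfl
  rw [hl, prod_inv_distrib, hgeom, htop, hcollect, hIcc]
  simp only [mul_pow, inv_pow, mul_inv, inv_inv, ← prod_pow, hfrob, hpow, add_assoc]
  ring

end

/-- For every `n ≥ 1`,
`∑_{j=0}^{n} (-1)^{n-j} · D_j⁻¹ · L_{n-j}^{-q^j} = 0`, i.e. the series
`exp(ξ) = ∑ ξ^{q^i}/D_i` and `log(ξ) = ∑ (-1)^j ξ^{q^j}/L_j` are compositional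
inverses of each other. -/
theorem drinfeld_exp_log_inverse_coefficients
    (p q N : ℕ) (hp : Nat.Prime p) (hq : ∃ e : ℕ, 0 < e ∧ q = p ^ e)
    (hN : 2 ≤ N)
    (F : Type*) [Field F] [CharP F p]
    (θ η : F) (hη : η ≠ 0) (hper : η ^ q ^ N = η)
    (hθη : ∀ a b : ℕ, θ ^ q ^ a ≠ η ^ q ^ b)
    (hθ : ∀ m : ℕ, 1 ≤ m → θ ^ q ^ m ≠ θ)
    (W : ℕ → ℕ) (hW : ∀ i, W i = (q ^ i - 1) / (q - 1))
    (D : ℕ → F) (hD0 : D 0 = 1)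
    (hDrec : ∀ i : ℕ, D (i + 1)
      = D i ^ q * (θ - θ ^ q ^ (i + 1)) / ((θ ^ q ^ (i + 1) - η) * (θ - η)))
    (L : ℕ → F) (hL0 : L 0 = 1)
    (hL : ∀ j : ℕ, 1 ≤ j → L j
      = (∏ m ∈ Finset.Icc 1 j, (θ - θ ^ q ^ m))
        * ((θ - η) ^ W j)⁻¹
        * ((θ - η ^ q ^ (N - 1)) ^ q ^ j)⁻¹
        * ∏ k ∈ Finset.range N, ((θ - η ^ q ^ k) ^ ((j + N - k - 2) / N))⁻¹) :
    ∀ n : ℕ, 1 ≤ n →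
      ∑ j ∈ Finset.range (n + 1),
        (-1 : F) ^ (n - j) * (D j)⁻¹ * (L (n - j) ^ q ^ j)⁻¹ = 0 := by
  obtain ⟨e, he, rfl⟩ := hq
  have : Fact p.Prime := ⟨hp⟩
  have hfrob : ∀ (a : ℕ) (x y : F), (x - y) ^ (p ^ e) ^ a = x ^ (p ^ e) ^ a - y ^ (p ^ e) ^ a := by
    intro a x y
    rw [← pow_mul]
    exact sub_pow_char_pow ..
  have hq2 : 2 ≤ p ^ e := hp.two_le.trans (Nat.le_self_pow he.ne' p)
  generalize p ^ e = q at *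
  have hinj : Function.Injective fun a : ℕ => θ ^ q ^ a := by
    have key : ∀ a b : ℕ, a < b → θ ^ q ^ a ≠ θ ^ q ^ b := by
      intro a b hab h
      obtain ⟨m, rfl⟩ := Nat.exists_eq_add_of_lt hab
      refine hθ (m + 1) (by omega) (sub_eq_zero.1 (eq_zero_of_pow_eq_zero (n := q ^ a) ?_))
      rw [hfrob, ← pow_mul, ← pow_add, h, sub_eq_zero]
      congr 2
      omega
    intro a b h
    by_contra hne
    rcases lt_or_gt_of_ne hne with hab | hab
    · exact key a b hab h
    · exact key b a hab h.symm
  intro n hn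
  obtain ⟨s, rfl⟩ := Nat.exists_eq_add_of_le' hn
  have hterm : ∀ j ∈ Finset.range (s + 1 + 1),
      (-1 : F) ^ (s + 1 - j) * (D j)⁻¹ * (L (s + 1 - j) ^ q ^ j)⁻¹
        = (-1) ^ (s + 1) * (θ ^ q ^ (s + 1) - η ^ q ^ s)
          * (∏ m ∈ Finset.range (s + 1), (θ ^ q ^ m - η ^ q ^ m))
          * ((∏ m ∈ Finset.range s, (θ ^ q ^ j - η ^ q ^ m))
            / ∏ m ∈ (Finset.range (s + 2)).erase j, (θ ^ q ^ j - θ ^ q ^ m)) := by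
    intro j hj
    have hneg : ∏ m ∈ Finset.range j, (θ ^ q ^ m - θ ^ q ^ j)
        = (-1) ^ j * ∏ m ∈ Finset.range j, (θ ^ q ^ j - θ ^ q ^ m) := by
      simpa using Finset.prod_neg (s := Finset.range j) (f := fun m => θ ^ q ^ j - θ ^ q ^ m)
    have hsign : ((-1 : F) ^ j)⁻¹ = (-1) ^ j := by rw [← inv_pow, inv_neg_one]
    have hsq : (-1 : F) ^ j * (-1) ^ j = 1 := by rw [← mul_pow]; simp
    rw [inv_expDenominator_eq_prod hfrob hD0 hDrec, Finset.prod_div_distrib,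
      Finset.prod_mul_distrib, hneg]
    rcases (Nat.lt_succ_iff.1 (Finset.mem_range.1 hj)).eq_or_lt with rfl | hlt
    · rw [prod_erase_range_add _ (s + 1) 0, Nat.sub_self, hL0, Finset.prod_range_succ _ s]
      simp only [div_eq_mul_inv, mul_inv, hsign, Finset.prod_range_zero, one_pow, inv_one, pow_zero]
      ring
    · obtain ⟨r, rfl⟩ := Nat.exists_eq_add_of_le (Nat.lt_succ_iff.1 hlt)
      rw [show j + r + 1 - j = r + 1 by omega,
        inv_logDenominator_pow_eq_prod hq2 (by omega) hfrob hper r j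
          (by rw [← hW]; exact hL (r + 1) (by omega)),
        show j + r + 2 = j + (r + 1) + 1 by omega, prod_erase_range_add,
        add_assoc j r 1, Finset.prod_range_add _ j (r + 1), Finset.prod_range_add _ j r,
        pow_add _ j (r + 1)]
      simp only [div_eq_mul_inv, mul_inv, hsign]
      ring
  rw [Finset.sum_congr rfl hterm, ← Finset.mul_sum,
    sum_prod_sub_div_prod_sub_eq_zero hinj fun m => η ^ q ^ m, mul_zero]
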